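/- Let G be a stacked triangulation on exactly 10 vertices with outer face {x,y,z}, let v be the unique vertex of G adjacent to all of x, y, z, and suppose that the sub-triangulation of G inside {v,x,y} has 6 vertices, that {v,y,z} is a face of G, and that the sub-triangulation of G inside {v,z,x} has 6 vertices. Then there exists a 6-vertex stacked triangulation G' with outer face {x,y,z}, obtained by stacking three new vertices (not vertices of G) inside the triangle {x,y,z}, such that for every edge guard set Γ' of G' there exists an edge guard set Γ of G with |Γ| ≤ |Γ'| + 1. -/

import Mathlib

namespace Guarding

/-- `IsStacked V E out F` means: the finite simple graph with vertex set `V`, edge set `E`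
(edges as unordered pairs), outer face `out` and set of inner faces `F`
(each face identified with its 3-element set of boundary vertices)
is a stacked triangulation, built by the inductive construction:
the triangle on three vertices is a stacked triangulation whose outer face is `{x,y,z}` and
whose set of inner faces is `{{x,y,z}}`; stacking a new vertex `v` into an inner face
`{x,y,z}` adds the edges `vx, vy, vz` and replaces the face `{x,y,z}` by the three faces
`{v,x,y}, {v,y,z}, {v,z,x}`. -/
inductive IsStacked : Finset ℕ → Finset (Sym2 ℕ) → Finset ℕ → Finset (Finset ℕ) → Prop
  | base (x y z : ℕ) (hxy : x ≠ y) (hyz : y ≠ z) (hxz : x ≠ z) :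
      IsStacked {x, y, z} {s(x, y), s(y, z), s(x, z)} {x, y, z} {{x, y, z}}
  | stack {V : Finset ℕ} {E : Finset (Sym2 ℕ)} {out : Finset ℕ} {F : Finset (Finset ℕ)}
      (x y z v : ℕ) (hG : IsStacked V E out F) (hf : ({x, y, z} : Finset ℕ) ∈ F)
      (hv : v ∉ V) :
      IsStacked (insert v V) (E ∪ {s(v, x), s(v, y), s(v, z)}) out
        ((F.erase {x, y, z}) ∪ {{v, x, y}, {v, y, z}, {v, z, x}})

/-- The faces of the stacked triangulation: its inner faces together with the outer face. -/
def faces (out : Finset ℕ) (F : Finset (Finset ℕ)) : Finset (Finset ℕ) := insert out F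

/-- `V(Γ)`: the set of all endpoints of edges of `Γ`. -/
def gv (Γ : Finset (Sym2 ℕ)) : Set ℕ := {u | ∃ e ∈ Γ, u ∈ e}

/-- `Γ` is an edge guard set: it consists of edges of the graph and every face
contains at least one endpoint of an edge of `Γ`. -/
def IsGuardSet (E : Finset (Sym2 ℕ)) (out : Finset ℕ) (F : Finset (Finset ℕ))
    (Γ : Finset (Sym2 ℕ)) : Prop :=
  Γ ⊆ E ∧ ∀ f ∈ faces out F, ∃ u ∈ gv Γ, u ∈ f

/-- `e` meets every face in `F`. -/
def Guards (e : Sym2 ℕ) (F : Finset (Finset ℕ)) : Prop := ∀ f ∈ F, ∃ u ∈ e, u ∈ f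

lemma guards_mk {a b : ℕ} {F : Finset (Finset ℕ)} (h : ∀ f ∈ F, a ∈ f ∨ b ∈ f) :
    Guards s(a, b) F := by
  intro f hf
  rcases h f hf with h | h
  · exact ⟨a, by simp, h⟩
  · exact ⟨b, by simp, h⟩

lemma ne_of_card_eq_three {a b c : ℕ} (h : ({a, b, c} : Finset ℕ).card = 3) :
    a ≠ b ∧ a ≠ c ∧ b ≠ c := by
  refine ⟨?_, ?_, ?_⟩ <;> rintro rfl <;> grind [Finset.card_le_two, Finset.pair_comm]

namespace IsStacked

variable {V : Finset ℕ} {E : Finset (Sym2 ℕ)} {out : Finset ℕ} {F : Finset (Finset ℕ)}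

lemma face_subset_and_card (h : IsStacked V E out F) : ∀ f ∈ F, f ⊆ V ∧ f.card = 3 := by
  induction h with
  | base x y z hxy hyz hxz =>
    intro f hf
    obtain rfl := Finset.mem_singleton.1 hf
    exact ⟨subset_rfl, Finset.card_eq_three.2 ⟨x, y, z, hxy, hxz, hyz, rfl⟩⟩
  | @stack V E out F x y z v hG hf hv ih =>
    intro f hf'
    obtain ⟨hsub, hcard⟩ := ih _ hf
    obtain ⟨hxy, hxz, hyz⟩ := ne_of_card_eq_three hcard
    have hx : x ∈ V := hsub (by simp)
    have hy : y ∈ V := hsub (by simp)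
    have hz : z ∈ V := hsub (by simp)
    have hvx : v ≠ x := by rintro rfl; exact hv hx
    have hvy : v ≠ y := by rintro rfl; exact hv hy
    have hvz : v ≠ z := by rintro rfl; exact hv hz
    simp only [Finset.mem_union, Finset.mem_erase, Finset.mem_insert,
      Finset.mem_singleton] at hf'
    rcases hf' with ⟨-, hf'⟩ | rfl | rfl | rfl
    · exact ⟨(ih f hf').1.trans (Finset.subset_insert _ _), (ih f hf').2⟩
    all_goals
      refine ⟨by intro u; simp; grind, Finset.card_eq_three.2 ⟨_, _, _, ?_, ?_, ?_, rfl⟩⟩ <;>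
      grind

lemma outer_subset_and_card (h : IsStacked V E out F) : out ⊆ V ∧ out.card = 3 := by
  induction h with
  | base x y z hxy hyz hxz =>
    exact ⟨subset_rfl, Finset.card_eq_three.2 ⟨x, y, z, hxy, hxz, hyz, rfl⟩⟩
  | stack x y z v hG hf hv ih => exact ⟨ih.1.trans (Finset.subset_insert _ _), ih.2⟩

/-- A stacked triangulation on three vertices is a triangle. -/
lemma of_card_three (h : IsStacked V E out F) (hV : V.card = 3) :
    F = {out} ∧ ∀ a ∈ out, ∀ b ∈ out, a ≠ b → s(a, b) ∈ E := by
  cases h with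
  | base x y z hxy hyz hxz =>
    refine ⟨rfl, ?_⟩
    simp only [Finset.mem_insert, Finset.mem_singleton]
    rintro a (rfl | rfl | rfl) b (rfl | rfl | rfl) hab <;> simp_all [Sym2.eq_swap]
  | @stack V E _ F x y z v hG hf hv =>
    have h₁ := Finset.card_le_card (hG.face_subset_and_card _ hf).1
    rw [(hG.face_subset_and_card _ hf).2] at h₁
    rw [Finset.card_insert_of_notMem hv] at hV
    omega

/-- The last stacking step of a stacked triangulation on more than three vertices. -/
lemma exists_last (h : IsStacked V E out F) {n : ℕ} (hV : V.card = n + 1) (hn : 3 ≤ n) :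
    ∃ V' E' F' v f, IsStacked V' E' out F' ∧ V'.card = n ∧ f ∈ F' ∧ v ∉ V' ∧ E' ⊆ E ∧
      (∀ u ∈ f, s(v, u) ∈ E) ∧
      ∀ g ∈ F, (g ∈ F' ∧ g ≠ f) ∨ ∃ u ∈ f, g = insert v (f.erase u) := by
  cases h with
  | base x y z hxy hyz hxz =>
    rw [Finset.card_eq_three.2 ⟨x, y, z, hxy, hxz, hyz, rfl⟩] at hV
    omega
  | @stack V E _ F x y z v hG hf hv =>
    rw [Finset.card_insert_of_notMem hv] at hV
    obtain ⟨hxy, hxz, hyz⟩ := ne_of_card_eq_three (hG.face_subset_and_card _ hf).2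
    refine ⟨V, E, F, v, {x, y, z}, hG, by omega, hf, hv, Finset.subset_union_left, ?_, ?_⟩
    · simp
    · intro g hg
      simp only [Finset.mem_union, Finset.mem_erase, Finset.mem_insert,
        Finset.mem_singleton] at hg
      rcases hg with ⟨h₁, h₂⟩ | rfl | rfl | rfl
      · exact Or.inl ⟨h₂, h₁⟩
      · exact Or.inr ⟨z, by simp, by ext u; simp; grind⟩
      · exact Or.inr ⟨x, by simp, by ext u; simp; grind⟩
      · exact Or.inr ⟨y, by simp, by ext u; simp; grind⟩

end IsStacked

/-- The inner faces created by stacking `v` into the triangle `{p, q, r}`. -/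
lemma eq_of_mem_stacked {p q r u v : ℕ} {g : Finset ℕ} (hpq : p ≠ q) (hpr : p ≠ r) (hqr : q ≠ r)
    (hu : u ∈ ({p, q, r} : Finset ℕ)) (hg : g = insert v (({p, q, r} : Finset ℕ).erase u)) :
    g = {v, p, q} ∨ g = {v, q, r} ∨ g = {v, p, r} := by
  have h₁ : ({p, q, r} : Finset ℕ).erase p = {q, r} := by ext; simp; grind
  have h₂ : ({p, q, r} : Finset ℕ).erase q = {p, r} := by ext; simp; grind
  have h₃ : ({p, q, r} : Finset ℕ).erase r = {p, q} := by ext; simp; grind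
  simp only [Finset.mem_insert, Finset.mem_singleton] at hu
  rcases hu with rfl | rfl | rfl
  · rw [h₁] at hg; exact Or.inr (Or.inl hg)
  · rw [h₂] at hg; exact Or.inr (Or.inr hg)
  · rw [h₃] at hg; exact Or.inl hg

namespace IsStacked

variable {V : Finset ℕ} {E : Finset (Sym2 ℕ)} {out : Finset ℕ} {F : Finset (Finset ℕ)}

/-- A stacked triangulation on five vertices arises from its outer face `{p, q, r}` by stacking `a`
into it and then `b` into `{a, p, q}`, for a suitable labelling. -/
lemma of_card_five (h : IsStacked V E out F) (hV : V.card = 5) :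
    ∃ p q r a b, out = {p, q, r} ∧ [p, q, r, a, b].Nodup ∧
      (∀ e ∈ [s(p, q), s(q, r), s(p, r), s(a, p), s(a, q), s(a, r)], e ∈ E) ∧
      ∀ f ∈ F, f = {b, a, p} ∨ f = {b, p, q} ∨ f = {b, a, q} ∨ f = {a, q, r} ∨ f = {a, p, r} := by
  obtain ⟨V₄, E₄, F₄, b, f, h₄, hV₄, hf, hb, hE₄, -, hF⟩ := h.exists_last hV (by norm_num)
  obtain ⟨V₃, E₃, F₃, a, f₃, h₃, hV₃, hf₃, ha, hE₃, hEa, hF₄⟩ := h₄.exists_last hV₄ le_rfl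
  obtain ⟨rfl, hadj⟩ := h₃.of_card_three hV₃
  obtain rfl := Finset.mem_singleton.1 hf₃
  obtain ⟨hsub, hcard⟩ := h₃.outer_subset_and_card
  have hfV := (h₄.face_subset_and_card f hf).1
  have hfV₃ := h₄.outer_subset_and_card.1
  obtain ⟨hf, hne⟩ | ⟨r, hr, rfl⟩ := hF₄ f hf
  · exact absurd (Finset.mem_singleton.1 hf) hne
  obtain ⟨p, q, hpq, hout⟩ : ∃ p q, p ≠ q ∧ f₃.erase r = {p, q} :=
    Finset.card_eq_two.1 (by rw [Finset.card_erase_of_mem hr, hcard])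
  have hrpq : r ∉ ({p, q} : Finset ℕ) := hout ▸ Finset.notMem_erase r f₃
  obtain rfl : f₃ = {p, q, r} := by
    rw [← Finset.insert_erase hr, hout]; ext; simp; tauto
  rw [hout] at hfV hF
  simp only [Finset.mem_insert, Finset.mem_singleton, not_or, ← ne_eq] at hrpq
  obtain ⟨hrp, hrq⟩ := hrpq
  have hap : a ≠ p := by rintro rfl; exact ha (hsub (by simp))
  have haq : a ≠ q := by rintro rfl; exact ha (hsub (by simp))
  have har : a ≠ r := by rintro rfl; exact ha (hsub (by simp))
  have hbp : b ≠ p := by rintro rfl; exact hb (hfV₃ (by simp))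
  have hbq : b ≠ q := by rintro rfl; exact hb (hfV₃ (by simp))
  have hbr : b ≠ r := by rintro rfl; exact hb (hfV₃ (by simp))
  have hba : b ≠ a := by rintro rfl; exact hb (hfV (by simp))
  refine ⟨p, q, r, a, b, rfl, by simp; tauto, ?_, ?_⟩
  · have h₁ := fun u hu w hw huw => hE₄ (hE₃ (hadj u hu w hw huw))
    have h₂ := fun u hu => hE₄ (hEa u hu)
    simp only [Finset.mem_insert, Finset.mem_singleton] at h₁ h₂
    simp only [List.mem_cons, List.not_mem_nil, or_false]
    rintro e (rfl | rfl | rfl | rfl | rfl | rfl)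
    · exact h₁ p (by simp) q (by simp) hpq
    · exact h₁ q (by simp) r (by simp) hrq.symm
    · exact h₁ p (by simp) r (by simp) hrp.symm
    · exact h₂ p (by simp)
    · exact h₂ q (by simp)
    · exact h₂ r (by simp)
  · intro g hg
    rcases hF g hg with ⟨hg, hgne⟩ | ⟨u, hu, hgu⟩
    · rcases hF₄ g hg with ⟨hg, hgne'⟩ | ⟨u, hu, hgu⟩
      · exact absurd (Finset.mem_singleton.1 hg) hgne'
      · rcases eq_of_mem_stacked hpq hrp.symm hrq.symm hu hgu with h | h | h <;> tauto
    · rcases eq_of_mem_stacked hap haq hpq hu hgu with h | h | h <;> tauto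

/-- Some edge of a stacked triangulation on six vertices guards all inner faces. Moreover, for each
outer vertex `y`, either such an edge can be chosen at `y`, or the inner faces avoiding the other
two outer vertices share a vertex adjacent to both of them. -/
lemma exists_guards (h : IsStacked V E out F) (hV : V.card = 6) :
    (∃ e ∈ E, Guards e F) ∧ ∀ y ∈ out, (∃ e ∈ E, y ∈ e ∧ Guards e F) ∨
      ∃ w, (∀ u ∈ out, u ≠ y → s(u, w) ∈ E) ∧
        ∀ f ∈ F, w ∈ f ∨ ∃ u ∈ out, u ≠ y ∧ u ∈ f := by
  obtain ⟨V, E', F', c, f, hG, hV', hf, -, hE, -, hF⟩ := h.exists_last hV (by norm_num)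
  obtain ⟨p, q, r, a, b, rfl, hnd, hE', hF'⟩ := hG.of_card_five hV'
  simp only [List.mem_cons, List.not_mem_nil, or_false, forall_eq_or_imp, forall_eq] at hE'
  obtain ⟨epq, eqr, epr, eap, eaq, ear⟩ := hE'
  replace epq := hE epq
  replace eqr := hE eqr
  replace epr := hE epr
  replace eap := hE eap
  replace eaq := hE eaq
  replace ear := hE ear
  have of_apex : ∀ y, (∀ f ∈ F, a ∈ f ∨ ∃ u ∈ ({p, q, r} : Finset ℕ), u ≠ y ∧ u ∈ f) →
      ∃ w, (∀ u ∈ ({p, q, r} : Finset ℕ), u ≠ y → s(u, w) ∈ E) ∧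
        ∀ f ∈ F, w ∈ f ∨ ∃ u ∈ ({p, q, r} : Finset ℕ), u ≠ y ∧ u ∈ f := by
    refine fun y h => ⟨a, ?_, h⟩
    simp only [Finset.mem_insert, Finset.mem_singleton]
    rintro u (rfl | rfl | rfl) - <;> rwa [Sym2.eq_swap]
  have of_self : ∀ y ∈ ({p, q, r} : Finset ℕ), (∀ f ∈ F, ∃ u ∈ ({p, q, r} : Finset ℕ), u ∈ f) →
      ∃ w, (∀ u ∈ ({p, q, r} : Finset ℕ), u ≠ y → s(u, w) ∈ E) ∧
        ∀ f ∈ F, w ∈ f ∨ ∃ u ∈ ({p, q, r} : Finset ℕ), u ≠ y ∧ u ∈ f := by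
    refine fun y hy h => ⟨y, ?_, fun f hf => ?_⟩
    · simp only [Finset.mem_insert, Finset.mem_singleton] at hy ⊢
      rcases hy with rfl | rfl | rfl <;> rintro u (rfl | rfl | rfl) hne <;>
        first | exact absurd rfl hne | assumption | rwa [Sym2.eq_swap]
    · obtain ⟨u, hu, huf⟩ := h f hf
      by_cases huy : u = y
      · exact Or.inl (huy ▸ huf)
      · exact Or.inr ⟨u, hu, huy, huf⟩
  simp only [List.nodup_cons, List.mem_cons, List.not_mem_nil, or_false, not_or] at hnd
  obtain ⟨⟨hpq, hpr, hpa, hpb⟩, ⟨hqr, hqa, hqb⟩, ⟨hra, hrb⟩, hab, -⟩ := hnd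
  have hFf : ∀ x y z, f = {x, y, z} → x ≠ y → x ≠ z → y ≠ z → ∀ g ∈ F,
      ((g = {b, a, p} ∨ g = {b, p, q} ∨ g = {b, a, q} ∨ g = {a, q, r} ∨ g = {a, p, r}) ∧
        g ≠ {x, y, z}) ∨ g = {c, x, y} ∨ g = {c, y, z} ∨ g = {c, x, z} := by
    rintro x y z rfl hxy hxz hyz g hg
    rcases hF g hg with ⟨hg, hne⟩ | ⟨u, hu, hgu⟩
    · exact Or.inl ⟨hF' g hg, hne⟩
    · exact Or.inr (eq_of_mem_stacked hxy hxz hyz hu hgu)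
  rcases hF' f hf with hf | hf | hf | hf | hf
  · replace hFf := hFf _ _ _ hf (Ne.symm hab) (Ne.symm hpb) (Ne.symm hpa)
    have hap : Guards s(a, p) F := guards_mk fun g hg => by
        rcases hFf g hg with ⟨rfl | rfl | rfl | rfl | rfl, hne⟩ | rfl | rfl | rfl <;>
          first | exact absurd rfl hne | simp
    refine ⟨⟨_, eap, hap⟩, fun y hy => ?_⟩
    by_cases hyp : y = p
    · exact Or.inl ⟨_, eap, by simp [hyp], hap⟩
    · exact Or.inr (of_apex y fun g hg => by
        rcases hFf g hg with ⟨rfl | rfl | rfl | rfl | rfl, hne⟩ | rfl | rfl | rfl <;>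
          first | exact absurd rfl hne | (simp; done) | (simp; omega))
  · replace hFf := hFf _ _ _ hf (Ne.symm hpb) (Ne.symm hqb) hpq
    have hpq' : ∀ g ∈ F, p ∈ g ∨ q ∈ g := fun g hg => by
        rcases hFf g hg with ⟨rfl | rfl | rfl | rfl | rfl, hne⟩ | rfl | rfl | rfl <;>
          first | exact absurd rfl hne | simp
    refine ⟨⟨_, epq, guards_mk hpq'⟩, fun y hy => Or.inr (of_self y hy fun g hg => ?_)⟩
    rcases hpq' g hg with h | h
    · exact ⟨p, by simp, h⟩
    · exact ⟨q, by simp, h⟩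
  · replace hFf := hFf _ _ _ hf (Ne.symm hab) (Ne.symm hqb) (Ne.symm hqa)
    have haq : Guards s(a, q) F := guards_mk fun g hg => by
        rcases hFf g hg with ⟨rfl | rfl | rfl | rfl | rfl, hne⟩ | rfl | rfl | rfl <;>
          first | exact absurd rfl hne | simp
    refine ⟨⟨_, eaq, haq⟩, fun y hy => ?_⟩
    by_cases hyq : y = q
    · exact Or.inl ⟨_, eaq, by simp [hyq], haq⟩
    · exact Or.inr (of_apex y fun g hg => by
        rcases hFf g hg with ⟨rfl | rfl | rfl | rfl | rfl, hne⟩ | rfl | rfl | rfl <;>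
          first | exact absurd rfl hne | (simp; done) | (simp; omega))
  · replace hFf := hFf _ _ _ hf (Ne.symm hqa) (Ne.symm hra) hqr
    exact ⟨⟨_, eaq, guards_mk fun g hg => by
        rcases hFf g hg with ⟨rfl | rfl | rfl | rfl | rfl, hne⟩ | rfl | rfl | rfl <;>
          first | exact absurd rfl hne | simp⟩,
      fun y hy => Or.inr (of_apex y fun g hg => by
        rcases hFf g hg with ⟨rfl | rfl | rfl | rfl | rfl, hne⟩ | rfl | rfl | rfl <;>
          first | exact absurd rfl hne | (simp; done) | (simp; omega))⟩
  · replace hFf := hFf _ _ _ hf (Ne.symm hpa) (Ne.symm hra) hpr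
    exact ⟨⟨_, eap, guards_mk fun g hg => by
        rcases hFf g hg with ⟨rfl | rfl | rfl | rfl | rfl, hne⟩ | rfl | rfl | rfl <;>
          first | exact absurd rfl hne | simp⟩,
      fun y hy => Or.inr (of_apex y fun g hg => by
        rcases hFf g hg with ⟨rfl | rfl | rfl | rfl | rfl, hne⟩ | rfl | rfl | rfl <;>
          first | exact absurd rfl hne | (simp; done) | (simp; omega))⟩

end IsStacked

/-- Let `G` be a `10`-vertex stacked triangulation with outer face `{x,y,z}`, let `v` be
the unique vertex adjacent to all of `x,y,z`, such that the sub-triangulation of `G`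
inside `{v,x,y}` has `6` vertices, `{v,y,z}` is a face of `G`, and the sub-triangulation
of `G` inside `{v,z,x}` has `6` vertices. Then there is a `6`-vertex stacked
triangulation `G'` with outer face `{x,y,z}`, obtained by stacking three new vertices
inside `{x,y,z}`, such that any edge guard set `Γ'` of `G'` yields an edge guard set of
`G` of size at most `|Γ'| + 1`. -/
theorem ten_vertex_reduction (V WA WB : Finset ℕ) (E EA EB : Finset (Sym2 ℕ))
    (F FA FB : Finset (Finset ℕ)) (x y z v : ℕ)
    (hG : IsStacked V E {x, y, z} F) (hn : V.card = 10)
    (hvV : v ∈ V) (hvx : s(v, x) ∈ E) (hvy : s(v, y) ∈ E) (hvz : s(v, z) ∈ E)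
    (hvu : ∀ u ∈ V, s(u, x) ∈ E → s(u, y) ∈ E → s(u, z) ∈ E → u = v)
    (hA : IsStacked WA EA {v, x, y} FA) (hAcard : WA.card = 6)
    (hAE : EA ⊆ E) (hAF : FA ⊆ F)
    (hface : ({v, y, z} : Finset ℕ) ∈ F)
    (hB : IsStacked WB EB {v, z, x} FB) (hBcard : WB.card = 6)
    (hBE : EB ⊆ E) (hBF : FB ⊆ F)
    (hV : V = WA ∪ WB) (hE : E = (EA ∪ EB) ∪ {s(y, z)})
    (hF : F = (FA ∪ FB) ∪ {{v, y, z}}) :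
    ∃ (V' : Finset ℕ) (E' : Finset (Sym2 ℕ)) (F' : Finset (Finset ℕ)),
      IsStacked V' E' {x, y, z} F' ∧ V'.card = 6 ∧ V' ∩ V = {x, y, z} ∧
      ∀ Γ' : Finset (Sym2 ℕ), IsGuardSet E' {x, y, z} F' Γ' →
        ∃ Γ : Finset (Sym2 ℕ), IsGuardSet E {x, y, z} F Γ ∧ Γ.card ≤ Γ'.card + 1 := by
  obtain ⟨hVo, hco⟩ := hG.outer_subset_and_card
  obtain ⟨hxy, hxz, hyz⟩ := ne_of_card_eq_three hco
  obtain ⟨hvx', hvy', -⟩ := ne_of_card_eq_three hA.outer_subset_and_card.2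
  obtain ⟨hvz', -, -⟩ := ne_of_card_eq_three hB.outer_subset_and_card.2
  have two_edges : ∃ Γ, IsGuardSet E {x, y, z} F Γ ∧ Γ.card ≤ 2 := by
    have pair : ∀ e₁ ∈ E, ∀ e₂ ∈ E,
        (∀ f ∈ faces {x, y, z} F, ∃ u, (u ∈ e₁ ∨ u ∈ e₂) ∧ u ∈ f) →
        ∃ Γ, IsGuardSet E {x, y, z} F Γ ∧ Γ.card ≤ 2 := by
      intro e₁ h₁ e₂ h₂ h
      refine ⟨{e₁, e₂}, ⟨?_, fun f hf => ?_⟩, Finset.card_le_two⟩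
      · intro e he
        simp only [Finset.mem_insert, Finset.mem_singleton] at he
        rcases he with rfl | rfl <;> assumption
      · obtain ⟨u, hu | hu, huf⟩ := h f hf
        · exact ⟨u, ⟨e₁, by simp, hu⟩, huf⟩
        · exact ⟨u, ⟨e₂, by simp, hu⟩, huf⟩
    have cover : ∀ P : Finset ℕ → Prop, P {x, y, z} → P {v, y, z} → (∀ f ∈ FA, P f) →
        (∀ f ∈ FB, P f) → ∀ f ∈ faces {x, y, z} F, P f := by
      intro P h₁ h₂ h₃ h₄ f hf
      simp only [faces, hF, Finset.mem_insert, Finset.mem_union, Finset.mem_singleton] at hf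
      rcases hf with rfl | (hf | hf) | rfl
      exacts [h₁, h₃ f hf, h₄ f hf, h₂]
    obtain ⟨⟨eA, heA, hgA⟩, hA'⟩ := hA.exists_guards hAcard
    obtain ⟨⟨eB, heB, hgB⟩, hB'⟩ := hB.exists_guards hBcard
    rcases hA' y (by simp) with ⟨e, he, hye, hg⟩ | ⟨p, hp, hpF⟩
    · refine pair e (hAE he) eB (hBE heB) (cover _ ⟨y, Or.inl hye, by simp⟩
        ⟨y, Or.inl hye, by simp⟩ (fun f hf => ?_) (fun f hf => ?_))
      · obtain ⟨u, hu, huf⟩ := hg f hf; exact ⟨u, Or.inl hu, huf⟩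
      · obtain ⟨u, hu, huf⟩ := hgB f hf; exact ⟨u, Or.inr hu, huf⟩
    rcases hB' z (by simp) with ⟨e, he, hze, hg⟩ | ⟨q, hq, hqF⟩
    · refine pair eA (hAE heA) e (hBE he) (cover _ ⟨z, Or.inr hze, by simp⟩
        ⟨z, Or.inr hze, by simp⟩ (fun f hf => ?_) (fun f hf => ?_))
      · obtain ⟨u, hu, huf⟩ := hgA f hf; exact ⟨u, Or.inl hu, huf⟩
      · obtain ⟨u, hu, huf⟩ := hg f hf; exact ⟨u, Or.inr hu, huf⟩
    · refine pair s(x, p) (hAE (hp x (by simp) hxy)) s(v, q) (hBE (hq v (by simp) hvz'))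
        (cover _ ⟨x, by simp, by simp⟩ ⟨v, by simp, by simp⟩ (fun f hf => ?_) (fun f hf => ?_))
      · rcases hpF f hf with h | ⟨u, hu, huy, huf⟩
        · exact ⟨p, by simp, h⟩
        · simp only [Finset.mem_insert, Finset.mem_singleton] at hu
          exact ⟨u, by simp; tauto, huf⟩
      · rcases hqF f hf with h | ⟨u, hu, huz, huf⟩
        · exact ⟨q, by simp, h⟩
        · simp only [Finset.mem_insert, Finset.mem_singleton] at hu
          exact ⟨u, by simp; tauto, huf⟩
  obtain ⟨Γ, hΓ, hΓ2⟩ := two_edges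
  obtain ⟨n, hlt⟩ : ∃ n, ∀ u ∈ V, u < n :=
    ⟨V.sup id + 1, fun u hu => Nat.lt_succ_of_le (Finset.le_sup (f := id) hu)⟩
  have hx := hlt x (hVo (by simp))
  have hy := hlt y (hVo (by simp))
  have hz := hlt z (hVo (by simp))
  have hv₁ : n ∉ ({x, y, z} : Finset ℕ) := by simp; omega
  have hv₂ : n + 1 ∉ insert n ({x, y, z} : Finset ℕ) := by simp; omega
  have hv₃ : n + 2 ∉ insert (n + 1) (insert n ({x, y, z} : Finset ℕ)) := by simp; omega
  have h₁ := (IsStacked.base x y z hxy hyz hxz).stack x y z n (by simp) hv₁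
  have h₂ := h₁.stack n x y (n + 1) (by simp) hv₂
  have h₃ := h₂.stack (n + 1) n x (n + 2) (by simp) hv₃
  refine ⟨_, _, _, h₃, ?_, ?_, fun Γ' hΓ' => ⟨Γ, hΓ, ?_⟩⟩
  · rw [Finset.card_insert_of_notMem hv₃, Finset.card_insert_of_notMem hv₂,
      Finset.card_insert_of_notMem hv₁, hco]
  · ext u
    have := hlt u
    have hsub := @hVo u
    simp only [Finset.mem_inter, Finset.mem_insert, Finset.mem_singleton] at hsub ⊢
    constructor
    · rintro ⟨h | h | h | h, hu⟩
      · have := this hu; omega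
      · have := this hu; omega
      · have := this hu; omega
      · exact h
    · intro h
      exact ⟨Or.inr (Or.inr (Or.inr h)), hsub h⟩
  · obtain ⟨u, ⟨e, he, -⟩, -⟩ := hΓ'.2 _ (Finset.mem_insert_self _ _)
    have := Finset.card_pos.2 ⟨e, he⟩
    omega

end Guarding
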